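/- Let W be a DBA-recognizable objective. W is half-positional over all arenas (of any cardinality, two-player) if and only if W is half-positional over finite one-player arenas. -/

import Mathlib

/-- Concatenate a finite word in front of an infinite word. -/
def extWord {C : Type} (w : List C) (s : ℕ → C) : ℕ → C :=
  fun n => if h : n < w.length then w.get ⟨n, h⟩ else s (n - w.length)

/-- Winning continuations `w⁻¹W` of a finite word `w` w.r.t. objective `W`. -/
def winCont {C : Type} (W : Set (ℕ → C)) (w : List C) : Set (ℕ → C) :=
  {s | extWord w s ∈ W}

/-- The run of a deterministic automaton from state `q` on infinite word `s`. -/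
def dbaRun {C Q : Type} (δ : Q → C → Q) (q : Q) (s : ℕ → C) : ℕ → Q
  | 0 => q
  | n + 1 => δ (dbaRun δ q s n) (s n)

/-- The set of infinite words accepted (Büchi condition on transitions `acc`) from state `q`. -/
def accFrom {C Q : Type} (δ : Q → C → Q) (acc : Q → C → Prop) (q : Q) : Set (ℕ → C) :=
  {s | ∀ N, ∃ n ≥ N, acc (dbaRun δ q s n) (s n)}

/-- Extension `δ*` of the transition function to finite words. -/
def dstar {C Q : Type} (δ : Q → C → Q) (q : Q) (w : List C) : Q := w.foldl δ q

/-- `Safe(q)`: finite words whose run from `q` takes no Büchi transition. -/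
def safeWords {C Q : Type} (δ : Q → C → Q) (acc : Q → C → Prop) (q : Q) : Set (List C) :=
  {w | ∀ (i : ℕ) (h : i < w.length), ¬ acc (dstar δ q (w.take i)) (w.get ⟨i, h⟩)}

/-- `SafeCycles(q)`: α-free words from `q` that return to `q`. -/
def safeCycles {C Q : Type} (δ : Q → C → Q) (acc : Q → C → Prop) (q : Q) : Set (List C) :=
  {w | w ∈ safeWords δ acc q ∧ dstar δ q w = q}

/-- A DBA is saturated if no strictly larger set of Büchi transitions recognizes the same language. -/
def Saturated {C Q : Type} (δ : Q → C → Q) (acc : Q → C → Prop) (qinit : Q) : Prop :=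
  ∀ acc' : Q → C → Prop, (∀ q c, acc q c → acc' q c) → acc' ≠ acc →
    accFrom δ acc' qinit ≠ accFrom δ acc qinit

/-- Prefix-independence of an objective. -/
def PrefixIndependent {C : Type} (W : Set (ℕ → C)) : Prop :=
  ∀ (w : List C) (s : ℕ → C), s ∈ W ↔ extWord w s ∈ W

/-- The Büchi condition: infinitely many letters in `F`. -/
def BuchiCond {C : Type} (F : Set C) : Set (ℕ → C) :=
  {s | ∀ N, ∃ n ≥ N, s n ∈ F}

/-- DBA-recognizability of an objective. -/
def DBARecognizable {C : Type} (W : Set (ℕ → C)) : Prop :=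
  ∃ (Q : Type) (_ : Fintype Q) (qinit : Q) (δ : Q → C → Q) (acc : Q → C → Prop),
    accFrom δ acc qinit = W

universe u

/-- An infinite play in an arena with edge set `E`. -/
def IsPlay {C : Type} {V : Type u} (E : Set (V × C × V)) (p : ℕ → V) (col : ℕ → C) : Prop :=
  ∀ n, (p n, col n, p (n + 1)) ∈ E

/-- A strategy of Player 1: from a history and the current vertex, choose a colored edge. -/
def Strat (C : Type) (V : Type u) : Type u := List (V × C) → V → C × V

/-- The history (sequence of visited vertices with emitted colors) after `n` steps. -/
def histPref {C : Type} {V : Type u} (p : ℕ → V) (col : ℕ → C) (n : ℕ) : List (V × C) :=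
  (List.range n).map fun i => (p i, col i)

/-- A strategy is valid if it always picks actual edges at Player-1 vertices. -/
def ValidStrat {C : Type} {V : Type u} (E : Set (V × C × V)) (own1 : V → Prop)
    (σ : Strat C V) : Prop :=
  ∀ h v, own1 v → (v, (σ h v).1, (σ h v).2) ∈ E

/-- A play is consistent with strategy `σ` if `σ`'s choices are followed at Player-1 vertices. -/
def ConsistentPlay {C : Type} {V : Type u} (own1 : V → Prop) (σ : Strat C V)
    (p : ℕ → V) (col : ℕ → C) : Prop :=
  ∀ n, own1 (p n) → (col n, p (n + 1)) = σ (histPref p col n) (p n)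

/-- `σ` is winning from `v` for objective `W`. -/
def WinningFrom {C : Type} {V : Type u} (W : Set (ℕ → C)) (E : Set (V × C × V))
    (own1 : V → Prop) (σ : Strat C V) (v : V) : Prop :=
  ∀ p col, IsPlay E p col → p 0 = v → ConsistentPlay own1 σ p col → col ∈ W

/-- A positional strategy only depends on the current vertex. -/
def PositionalStrat {C : Type} {V : Type u} (σ : Strat C V) : Prop :=
  ∀ h h' v, σ h v = σ h' v

/-- Player 1 has a single positional strategy, optimal in the arena `(E, own1)`. -/
def HalfPosArena {C : Type} {V : Type u} (W : Set (ℕ → C)) (E : Set (V × C × V))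
    (own1 : V → Prop) : Prop :=
  ∃ σ : Strat C V, ValidStrat E own1 σ ∧ PositionalStrat σ ∧
    ∀ v, (∃ τ : Strat C V, ValidStrat E own1 τ ∧ WinningFrom W E own1 τ v) →
      WinningFrom W E own1 σ v

/-- Half-positionality over all (non-blocking) arenas of any cardinality. -/
def HalfPositionalAll {C : Type} (W : Set (ℕ → C)) : Prop :=
  ∀ (V : Type u) (E : Set (V × C × V)) (own1 : V → Prop),
    (∀ v, ∃ c v', (v, c, v') ∈ E) → HalfPosArena W E own1

/-- Half-positionality over finite one-player (all vertices to Player 1) arenas. -/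
def HalfPosFinOnePlayer {C : Type} (W : Set (ℕ → C)) : Prop :=
  ∀ (V : Type) [Fintype V] (E : Set (V × C × V)),
    (∀ v, ∃ c v', (v, c, v') ∈ E) → HalfPosArena W E (fun _ => True)

section Words

variable {C : Type}

/-- Prepend a letter to an infinite word. -/
def scons (c : C) (s : ℕ → C) : ℕ → C
  | 0 => c
  | n + 1 => s n

/-- The suffix of an infinite word starting at position `i`. -/
def sdrop (s : ℕ → C) (i : ℕ) : ℕ → C := fun n => s (i + n)

/-- The factor of length `k` of an infinite word starting at position `i`. -/
def seg (s : ℕ → C) : ℕ → ℕ → List C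
  | _, 0 => []
  | i, k + 1 => s i :: seg s (i + 1) k

theorem extWord_nil (s : ℕ → C) : extWord [] s = s := by
  funext n; simp [extWord]

theorem extWord_cons (c : C) (w : List C) (s : ℕ → C) :
    extWord (c :: w) s = scons c (extWord w s) := by
  funext n
  cases n with
  | zero => simp [extWord, scons]
  | succ n => simp [extWord, scons]

theorem extWord_append (u v : List C) (s : ℕ → C) :
    extWord (u ++ v) s = extWord u (extWord v s) := by
  induction u with
  | nil => simp [extWord_nil]
  | cons c u ih => simp [extWord_cons, ih]

theorem scons_sdrop (s : ℕ → C) (i : ℕ) : scons (s i) (sdrop s (i + 1)) = sdrop s i := by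
  funext n
  cases n with
  | zero => simp [scons, sdrop]
  | succ n => simp only [scons, sdrop]; congr 1; omega

theorem sdrop_zero (s : ℕ → C) : sdrop s 0 = s := by
  funext n; simp [sdrop]

theorem extWord_seg (s : ℕ → C) (i k : ℕ) :
    extWord (seg s i k) (sdrop s (i + k)) = sdrop s i := by
  induction k generalizing i with
  | zero => simp [seg, extWord_nil]
  | succ k ih =>
    have := ih (i + 1)
    rw [show i + 1 + k = i + (k + 1) by omega] at this
    simp only [seg, extWord_cons, this, scons_sdrop]

/-- Every nonempty word has an infinite power. -/
theorem exists_omega_power (w : List C) (hw : w ≠ []) : ∃ s, s = extWord w s := by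
  have hl : 0 < w.length := List.length_pos_iff.mpr hw
  refine ⟨fun n => w.get ⟨n % w.length, Nat.mod_lt _ hl⟩, ?_⟩
  funext n
  unfold extWord
  split_ifs with h
  · simp [Nat.mod_eq_of_lt h]
  · congr 2
    exact Nat.mod_eq_sub_mod (not_lt.mp h)

/-- The `k`-th power of a finite word. -/
def wpow (w : List C) : ℕ → List C
  | 0 => []
  | k + 1 => w ++ wpow w k

theorem wpow_add (w : List C) (i j : ℕ) : wpow w (i + j) = wpow w i ++ wpow w j := by
  induction i with
  | zero => simp [wpow]
  | succ i ih => rw [Nat.add_right_comm]; simp [wpow, ih]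

theorem extWord_wpow {w : List C} {s : ℕ → C} (h : s = extWord w s) (k : ℕ) :
    s = extWord (wpow w k) s := by
  induction k with
  | zero => simp [wpow, extWord_nil]
  | succ k ih => rw [wpow, extWord_append, ← ih, ← h]

theorem frequently_fiber {X : Type*} [Finite X] {P : ℕ → Prop} (r : ℕ → X)
    (h : ∀ N, ∃ n ≥ N, P n) : ∃ x, ∀ N, ∃ n ≥ N, P n ∧ r n = x := by
  by_contra hc
  push Not at hc
  choose M hM using hc
  obtain ⟨B, hB⟩ := (Set.finite_range M).bddAbove
  obtain ⟨n, hn, hP⟩ := h B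
  exact hM (r n) n (le_trans (hB ⟨_, rfl⟩) hn) hP rfl

end Words

section Automata

variable {C Q : Type} (δ : Q → C → Q) (acc : Q → C → Prop)

/-- The run from `q` on the finite word takes a Büchi transition. -/
def hits : Q → List C → Prop
  | _, [] => False
  | q, c :: w => acc q c ∨ hits (δ q c) w

theorem dstar_append (q : Q) (u v : List C) :
    dstar δ q (u ++ v) = dstar δ (dstar δ q u) v := by
  simp [dstar]

theorem hits_append (q : Q) (u v : List C) :
    hits δ acc q (u ++ v) ↔ hits δ acc q u ∨ hits δ acc (dstar δ q u) v := by
  induction u generalizing q with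
  | nil => simp [hits, dstar]
  | cons c u ih => simp [hits, ih, dstar, or_assoc]

theorem dbaRun_scons (q : Q) (c : C) (s : ℕ → C) (n : ℕ) :
    dbaRun δ q (scons c s) (n + 1) = dbaRun δ (δ q c) s n := by
  induction n with
  | zero => simp [dbaRun, scons]
  | succ n ih => rw [dbaRun, ih, dbaRun]; rfl

theorem dbaRun_sdrop (q : Q) (s : ℕ → C) (i n : ℕ) :
    dbaRun δ (dbaRun δ q s i) (sdrop s i) n = dbaRun δ q s (i + n) := by
  induction n with
  | zero => rfl
  | succ n ih => rw [dbaRun, ih, ← add_assoc, dbaRun]; rfl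

theorem dstar_seg (q : Q) (s : ℕ → C) (i k : ℕ) :
    dstar δ (dbaRun δ q s i) (seg s i k) = dbaRun δ q s (i + k) := by
  induction k generalizing i with
  | zero => simp [seg, dstar]
  | succ k ih =>
    have := ih (i + 1)
    rw [show i + 1 + k = i + (k + 1) by omega] at this
    rw [← this]; simp [seg, dstar, dbaRun]

theorem hits_seg (q : Q) (s : ℕ → C) (i k : ℕ) :
    hits δ acc (dbaRun δ q s i) (seg s i k) ↔
      ∃ m, i ≤ m ∧ m < i + k ∧ acc (dbaRun δ q s m) (s m) := by
  induction k generalizing i with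
  | zero => simp only [seg, hits, false_iff]; rintro ⟨m, h1, h2, -⟩; omega
  | succ k ih =>
    have h := ih (i + 1)
    rw [dbaRun] at h
    simp only [seg, hits, h]
    constructor
    · rintro (h | ⟨m, h1, h2, h3⟩)
      · exact ⟨i, le_rfl, by omega, h⟩
      · exact ⟨m, by omega, by omega, h3⟩
    · rintro ⟨m, h1, h2, h3⟩
      rcases eq_or_lt_of_le h1 with rfl | h
      · exact Or.inl h3
      · exact Or.inr ⟨m, h, by omega, h3⟩

theorem scons_mem_accFrom (q : Q) (c : C) (s : ℕ → C) :
    scons c s ∈ accFrom δ acc q ↔ s ∈ accFrom δ acc (δ q c) := by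
  constructor
  · intro h N
    obtain ⟨n, hn, ha⟩ := h (N + 1)
    obtain ⟨m, rfl⟩ : ∃ m, n = m + 1 := ⟨n - 1, by omega⟩
    rw [dbaRun_scons] at ha
    exact ⟨m, by omega, ha⟩
  · intro h N
    obtain ⟨n, hn, ha⟩ := h N
    refine ⟨n + 1, by omega, ?_⟩
    rw [dbaRun_scons]; exact ha

theorem extWord_mem_accFrom (q : Q) (w : List C) (s : ℕ → C) :
    extWord w s ∈ accFrom δ acc q ↔ s ∈ accFrom δ acc (dstar δ q w) := by
  induction w generalizing q with
  | nil => simp [extWord_nil, dstar]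
  | cons c w ih => rw [extWord_cons, scons_mem_accFrom, ih]; rfl

theorem sdrop_mem_accFrom (q : Q) (s : ℕ → C) (i : ℕ) :
    sdrop s i ∈ accFrom δ acc (dbaRun δ q s i) ↔ s ∈ accFrom δ acc q := by
  have h := extWord_seg s 0 i
  have h2 := dstar_seg δ q s 0 i
  rw [zero_add] at h h2
  rw [← h2, show dbaRun δ q s 0 = q from rfl, ← extWord_mem_accFrom, h, sdrop_zero]

theorem exists_acc_of_hits {q : Q} {w : List C} (h : hits δ acc q w) (s : ℕ → C) :
    ∃ n, acc (dbaRun δ q (extWord w s) n) (extWord w s n) := by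
  induction w generalizing q with
  | nil => exact h.elim
  | cons c w ih =>
    rcases h with h | h
    · exact ⟨0, by simpa [dbaRun, extWord_cons, scons] using h⟩
    · obtain ⟨n, hn⟩ := ih h
      exact ⟨n + 1, by rw [extWord_cons, dbaRun_scons]; exact hn⟩

/-- If all states of a set stable under `w` hit a Büchi transition when reading `w`, then
`w ^ ω` is accepted from each of them. -/
theorem omega_power_mem_of_hits {w : List C} {s : ℕ → C} (hs : s = extWord w s) (S : Set Q)
    (hS : ∀ q ∈ S, dstar δ q w ∈ S ∧ hits δ acc q w) {q : Q} (hq : q ∈ S) :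
    s ∈ accFrom δ acc q := by
  have hw : w ≠ [] := by
    rintro rfl
    exact (hS q hq).2
  intro N
  induction N generalizing q with
  | zero =>
    obtain ⟨n, hn⟩ := exists_acc_of_hits δ acc (hS q hq).2 s
    rw [← hs] at hn
    exact ⟨n, by omega, hn⟩
  | succ N ih =>
    obtain ⟨n, hn, ha⟩ := ih (hS q hq).1
    have key : ∀ (w : List C) (q : Q), ∃ m ≥ n + w.length,
        acc (dbaRun δ (dstar δ q w) s n) (s n) →
          acc (dbaRun δ q (extWord w s) m) (extWord w s m) := by
      intro w
      induction w with
      | nil => intro q; exact ⟨n, by simp, by simp [extWord_nil, dstar]⟩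
      | cons c w ih =>
        intro q
        obtain ⟨m, hm, h⟩ := ih (δ q c)
        refine ⟨m + 1, by simp; omega, fun h' => ?_⟩
        rw [extWord_cons, dbaRun_scons]
        exact h h'
    obtain ⟨m, hm, h⟩ := key w q
    have hl : 0 < w.length := List.length_pos_iff.mpr hw
    refine ⟨m, by omega, ?_⟩
    have := h ha
    rwa [← hs] at this

theorem omega_power_notMem_of_not_hits {w : List C} {s : ℕ → C} (hs : s = extWord w s)
    (hw : w ≠ []) {q : Q} (hq : dstar δ q w = q) (hh : ¬ hits δ acc q w) :
    s ∉ accFrom δ acc q := by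
  have key : ∀ n, ∀ (p : Q) (v : List C) (t : ℕ → C), t = extWord v s → dstar δ p v = q →
      ¬ hits δ acc p v → ¬ acc (dbaRun δ p t n) (t n) := by
    have wlog_cons : ∀ (p : Q) (v : List C) (t : ℕ → C), t = extWord v s → dstar δ p v = q →
        ¬ hits δ acc p v → ∃ c u, t = scons c (extWord u s) ∧ dstar δ (δ p c) u = q ∧
          ¬ acc p c ∧ ¬ hits δ acc (δ p c) u := by
      have cons : ∀ (p : Q) (v : List C) (t : ℕ → C), v ≠ [] → t = extWord v s →
          dstar δ p v = q → ¬ hits δ acc p v → ∃ c u, t = scons c (extWord u s) ∧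
            dstar δ (δ p c) u = q ∧ ¬ acc p c ∧ ¬ hits δ acc (δ p c) u := by
        intro p v t hv ht hp hh
        cases v with
        | nil => exact (hv rfl).elim
        | cons c u =>
          simp only [hits, not_or] at hh
          exact ⟨c, u, by rw [ht, extWord_cons], hp, hh.1, hh.2⟩
      intro p v t ht hp hh'
      cases v with
      | nil =>
        have hpq : p = q := hp
        subst hpq
        exact cons p w t hw (by rw [ht, extWord_nil]; exact hs) hq hh
      | cons c u => exact cons p (c :: u) t (by simp) ht hp hh'
    intro n
    induction n with
    | zero =>
      intro p v t ht hp hh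
      obtain ⟨c, u, rfl, -, h, -⟩ := wlog_cons p v t ht hp hh
      simpa [dbaRun, scons] using h
    | succ n ih =>
      intro p v t ht hp hh
      obtain ⟨c, u, rfl, h1, -, h2⟩ := wlog_cons p v t ht hp hh
      rw [dbaRun_scons]
      exact ih _ u _ rfl h1 h2
  intro h
  obtain ⟨n, -, ha⟩ := h 0
  exact key n q [] s (extWord_nil s).symm rfl (by simp [hits]) ha

/-- A word separating two states can be chosen ultimately periodic. -/
theorem exists_ultimately_periodic [Finite Q] {p q : Q}
    (h : ¬ accFrom δ acc p ⊆ accFrom δ acc q) :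
    ∃ (u w : List C) (s : ℕ → C), w ≠ [] ∧ s = extWord w s ∧
      extWord u s ∈ accFrom δ acc p ∧ extWord u s ∉ accFrom δ acc q := by
  obtain ⟨t, hp, hq⟩ := Set.not_subset.mp h
  have hq' : ∃ N, ∀ n ≥ N, ¬ acc (dbaRun δ q t n) (t n) := by
    simpa [accFrom] using hq
  obtain ⟨N, hN⟩ := hq'
  obtain ⟨⟨a, b⟩, hab⟩ := frequently_fiber (P := fun _ => True)
    (fun n => (dbaRun δ p t n, dbaRun δ q t n)) (fun N => ⟨N, le_rfl, trivial⟩)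
  obtain ⟨i, hi, -, hi'⟩ := hab N
  obtain ⟨m, hm, hacc⟩ := hp i
  obtain ⟨j, hj, -, hj'⟩ := hab (m + 1)
  simp only [Prod.mk.injEq] at hi' hj'
  obtain ⟨k, rfl⟩ : ∃ k, j = i + (k + 1) := ⟨j - i - 1, by omega⟩
  have hw : seg t i (k + 1) ≠ [] := by simp [seg]
  obtain ⟨s, hs⟩ := exists_omega_power _ hw
  refine ⟨seg t 0 i, _, s, hw, hs, ?_, ?_⟩
  · have h1 := dstar_seg δ p t 0 i
    rw [zero_add, hi'.1] at h1
    rw [extWord_mem_accFrom, show p = dbaRun δ p t 0 from rfl, h1]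
    refine omega_power_mem_of_hits δ acc hs {a} ?_ rfl
    rintro _ rfl
    have h2 := dstar_seg δ p t i (k + 1)
    have h3 := hits_seg δ acc p t i (k + 1)
    rw [hi'.1] at h2 h3
    exact ⟨h2.trans hj'.1, h3.mpr ⟨m, hm, by omega, hacc⟩⟩
  · have h1 := dstar_seg δ q t 0 i
    rw [zero_add, hi'.2] at h1
    rw [extWord_mem_accFrom, show q = dbaRun δ q t 0 from rfl, h1]
    have h2 := dstar_seg δ q t i (k + 1)
    have h3 := hits_seg δ acc q t i (k + 1)
    rw [hi'.2] at h2 h3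
    refine omega_power_notMem_of_not_hits δ acc hs hw (h2.trans hj'.2) ?_
    rw [h3]
    rintro ⟨m', h4, -, h5⟩
    exact hN m' (by omega) h5

end Automata

section OneChoiceArenas

variable {C : Type}

theorem histPref_length {V : Type u} (p : ℕ → V) (col : ℕ → C) (n : ℕ) :
    (histPref p col n).length = n := by
  simp [histPref]

/-- In a one-player arena, a winning play yields a winning strategy. -/
theorem exists_winning_of_play {V : Type u} {W : Set (ℕ → C)} {E : Set (V × C × V)}
    (hE : ∀ v, ∃ c v', (v, c, v') ∈ E) {p : ℕ → V} {col : ℕ → C} (hp : IsPlay E p col)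
    (hcol : col ∈ W) :
    ∃ τ : Strat C V, ValidStrat E (fun _ => True) τ ∧
      WinningFrom W E (fun _ => True) τ (p 0) := by
  classical
  choose f g hfg using hE
  refine ⟨fun h v => if v = p h.length then (col h.length, p (h.length + 1)) else (f v, g v),
    ?_, ?_⟩
  · intro h v _
    by_cases hv : v = p h.length
    · subst hv; simpa using hp h.length
    · simpa [hv] using hfg v
  · intro p' col' hp' h0 hc
    have key : ∀ n, p' n = p n := by
      intro n
      induction n with
      | zero => exact h0
      | succ n ih =>
        have := hc n trivial
        simp only [histPref_length, if_pos ih] at this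
        exact (Prod.mk.inj this).2
    have : col' = col := by
      funext n
      have := hc n trivial
      simp only [histPref_length, if_pos (key n)] at this
      exact (Prod.mk.inj this).1
    rwa [this]

/-- The word `s` can be read from `x` when each step follows one of the functions `step b`
with `b ∈ B`. -/
def Reads {X : Type} (step : Bool → X → C × X) (B : Set Bool) (x : X) (s : ℕ → C) : Prop :=
  ∃ p : ℕ → X, p 0 = x ∧ ∀ n, ∃ b ∈ B, (s n, p (n + 1)) = step b (p n)

theorem reads_of_coinductive {X : Type} {step : Bool → X → C × X} {B : Set Bool}
    (R : X → (ℕ → C) → Prop)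
    (hR : ∀ x s, R x s → ∃ b ∈ B, ∃ c y t, s = scons c t ∧ (c, y) = step b x ∧ R y t)
    {x : X} {s : ℕ → C} (h : R x s) : Reads step B x s := by
  have h1 : ∀ a : {a : X × (ℕ → C) // R a.1 a.2}, ∃ a' : {a : X × (ℕ → C) // R a.1 a.2},
      ∃ b ∈ B, ∃ c, a.1.2 = scons c a'.1.2 ∧ (c, a'.1.1) = step b a.1.1 := by
    rintro ⟨⟨x, s⟩, h⟩
    obtain ⟨b, hb, c, y, t, h1, h2, h3⟩ := hR x s h
    exact ⟨⟨(y, t), h3⟩, b, hb, c, h1, h2⟩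
  choose f hf using h1
  let a : ℕ → {a : X × (ℕ → C) // R a.1 a.2} := fun n => f^[n] ⟨(x, s), h⟩
  have ha : ∀ n, a (n + 1) = f (a n) := fun n => Function.iterate_succ_apply' f n _
  have hs : ∀ n, (a n).1.2 = sdrop s n := by
    intro n
    induction n with
    | zero => exact (sdrop_zero s).symm
    | succ n ih =>
      obtain ⟨b, -, c, h1, -⟩ := hf (a n)
      rw [← ha, ih, ← scons_sdrop] at h1
      funext m
      exact (congrFun h1 (m + 1)).symm
  refine ⟨fun n => (a n).1.1, rfl, fun n => ?_⟩
  obtain ⟨b, hb, c, h1, h2⟩ := hf (a n)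
  refine ⟨b, hb, ?_⟩
  rw [hs] at h1
  rw [← h2, ← ha, show s n = c from congrFun h1 0]

/-- Half-positionality applied to a finite one-player arena in which a single vertex `hub` has
two outgoing edges and every other vertex has only one. -/
theorem exists_positional_choice {W : Set (ℕ → C)} (hW : HalfPosFinOnePlayer W) {X : Type}
    {step : Bool → X → C × X} {hub : X} (hagree : ∀ x ≠ hub, ∀ b b', step b x = step b' x)
    {S : Set X} (hS : S.Finite) (hhub : hub ∈ S) (hclosed : ∀ b, ∀ x ∈ S, (step b x).2 ∈ S) :
    ∃ b, ∀ x ∈ S, ∀ s ∈ W, Reads step Set.univ x s → ∀ s', Reads step {b} x s' → s' ∈ W := by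
  have := hS.fintype
  let E : Set (S × C × S) := {e | ∃ b, (e.2.1, (e.2.2 : X)) = step b e.1}
  have hE : ∀ v, ∃ c v', (v, c, v') ∈ E :=
    fun v => ⟨(step true v).1, ⟨_, hclosed true v.1 v.2⟩, true, rfl⟩
  obtain ⟨σ, hv, hpos, hσ⟩ := hW S E hE
  obtain ⟨b, hb⟩ := hv [] ⟨hub, hhub⟩ trivial
  have hσb : ∀ h x, ((σ h x).1, ((σ h x).2 : X)) = step b x := by
    intro h x
    rw [hpos h [] x]
    by_cases hx : x = ⟨hub, hhub⟩
    · subst hx; exact hb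
    · obtain ⟨b', hb'⟩ := hv [] x trivial
      exact hb'.trans (hagree x.1 (fun h => hx (Subtype.ext h)) b' b)
  have lift : ∀ p : ℕ → X, p 0 ∈ S → ∀ s : ℕ → C,
      (∀ n, ∃ b, (s n, p (n + 1)) = step b (p n)) → ∀ n, p n ∈ S := by
    intro p h0 s hp n
    induction n with
    | zero => exact h0
    | succ n ih =>
      obtain ⟨b, hb⟩ := hp n
      have := hclosed b _ ih
      rwa [← hb] at this
  refine ⟨b, ?_⟩
  rintro x hx s hs ⟨p, rfl, hp⟩ s' ⟨p', h0, hp'⟩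
  have hpS := lift p hx s (fun n => (hp n).imp fun _ h => h.2)
  have hpS' := lift p' (h0 ▸ hx) s' (fun n => (hp' n).imp fun _ h => h.2)
  have hplay : IsPlay E (fun n => (⟨p n, hpS n⟩ : S)) s := by
    intro n
    obtain ⟨b, -, hb⟩ := hp n
    exact ⟨b, hb⟩
  have hwin := hσ ⟨p 0, hpS 0⟩ (exists_winning_of_play hE hplay hs)
  refine hwin (fun n => ⟨p' n, hpS' n⟩) s' ?_ (Subtype.ext h0) ?_
  · intro n
    obtain ⟨b, -, hb⟩ := hp' n
    exact ⟨b, hb⟩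
  · intro n _
    obtain ⟨b', hb', h1⟩ := hp' n
    rw [Set.mem_singleton_iff] at hb'
    subst hb'
    have h2 := hσb (histPref (fun n => (⟨p' n, hpS' n⟩ : S)) s' n) ⟨p' n, hpS' n⟩
    rw [← h1, Prod.mk.injEq] at h2
    exact Prod.ext h2.1.symm (Subtype.ext h2.2.symm)

/-- Vertices of word arenas: `none` is the hub, and `some (c, l, t)` is a vertex from which the
word `c :: l` has to be read before going to the hub (`t = none`) or to the start of the
`j`-th terminal cycle (`t = some j`). -/
abbrev WordVertex (C : Type) : Type := Option (C × List C × Option Bool)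

/-- The vertex reached once a word has been read completely. -/
def wordTarget (loop : Bool → C × List C) : Option Bool → WordVertex C
  | none => none
  | some j => some ((loop j).1, (loop j).2, some j)

/-- The vertex from which the word `l` has to be read before going to the target `t`. -/
def wordEnter (loop : Bool → C × List C) : List C → Option Bool → WordVertex C
  | [], t => wordTarget loop t
  | c :: l, t => some (c, l, t)

/-- The moves of the word arena with terminal cycles `loop` and hub options `opt`. -/
def wordStep (loop : Bool → C × List C) (opt : Bool → C × List C × Option Bool) (b : Bool) :
    WordVertex C → C × WordVertex C
  | none => ((opt b).1, wordEnter loop (opt b).2.1 (opt b).2.2)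
  | some (c, l, t) => (c, wordEnter loop l t)

variable {loop : Bool → C × List C} {opt : Bool → C × List C × Option Bool}

theorem reads_step {b : Bool} {B : Set Bool} (hb : b ∈ B) {x y : WordVertex C} {c : C}
    {s : ℕ → C} (hxy : (c, y) = wordStep loop opt b x) (h : Reads (wordStep loop opt) B y s) :
    Reads (wordStep loop opt) B x (scons c s) := by
  obtain ⟨p, rfl, hp⟩ := h
  refine ⟨fun n => Nat.casesOn n x p, rfl, fun n => ?_⟩
  cases n with
  | zero => exact ⟨b, hb, hxy⟩
  | succ n => exact hp n

theorem reads_enter {B : Set Bool} (hB : B.Nonempty) {t : Option Bool} {s : ℕ → C}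
    (h : Reads (wordStep loop opt) B (wordTarget loop t) s) (l : List C) :
    Reads (wordStep loop opt) B (wordEnter loop l t) (extWord l s) := by
  obtain ⟨b, hb⟩ := hB
  induction l with
  | nil => rw [extWord_nil]; exact h
  | cons c l ih => rw [extWord_cons]; exact reads_step hb rfl ih

theorem reads_option {b : Bool} {B : Set Bool} (hb : b ∈ B) {s : ℕ → C}
    (h : Reads (wordStep loop opt) B (wordTarget loop (opt b).2.2) s) :
    Reads (wordStep loop opt) B none (extWord ((opt b).1 :: (opt b).2.1) s) := by
  rw [extWord_cons]
  exact reads_step hb rfl (reads_enter ⟨b, hb⟩ h _)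

theorem reads_terminal {B : Set Bool} (hB : B.Nonempty) {j : Bool} {s : ℕ → C}
    (hs : s = extWord ((loop j).1 :: (loop j).2) s) :
    Reads (wordStep loop opt) B (wordTarget loop (some j)) s := by
  obtain ⟨b, hb⟩ := hB
  refine reads_of_coinductive
    (fun x t => ∃ l, x = wordEnter loop l (some j) ∧ t = extWord l s) ?_
    ⟨[], rfl, (extWord_nil s).symm⟩
  rintro _ _ ⟨l, rfl, rfl⟩
  refine ⟨b, hb, ?_⟩
  cases l with
  | nil =>
    refine ⟨_, _, _, ?_, rfl, _, rfl, rfl⟩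
    rw [extWord_nil, ← extWord_cons]
    exact hs
  | cons c l => exact ⟨_, _, _, extWord_cons c l s, rfl, l, rfl, rfl⟩

theorem reads_hub {B : Set Bool} (S : Bool → ℕ → C) (f : Bool → Bool)
    (hopt : ∀ b ∈ B, f b ∈ B ∧ (opt b).2.2 = none ∧
      S b = extWord ((opt b).1 :: (opt b).2.1) (S (f b))) {b : Bool} (hb : b ∈ B) :
    Reads (wordStep loop opt) B none (S b) := by
  refine reads_of_coinductive
    (fun x t => ∃ b ∈ B, ∃ l, x = wordEnter loop l none ∧ t = extWord l (S b)) ?_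
    ⟨b, hb, [], rfl, (extWord_nil _).symm⟩
  rintro _ _ ⟨b, hb, l, rfl, rfl⟩
  obtain ⟨hf, ht, hS⟩ := hopt b hb
  refine ⟨b, hb, ?_⟩
  cases l with
  | nil =>
    refine ⟨(opt b).1, _, extWord (opt b).2.1 (S (f b)), ?_, rfl, f b, hf, (opt b).2.1, ?_, rfl⟩
    · rw [extWord_nil, ← extWord_cons]; exact hS
    · rw [ht]
  | cons c l => exact ⟨_, _, _, extWord_cons c l _, rfl, b, hb, l, rfl, rfl⟩

theorem exists_positional_option {W : Set (ℕ → C)} (hW : HalfPosFinOnePlayer W)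
    (loop : Bool → C × List C) (opt : Bool → C × List C × Option Bool) (z₁ z₂ : List C) :
    ∃ b, ∀ z, z = z₁ ∨ z = z₂ → ∀ s, Reads (wordStep loop opt) Set.univ none s →
      extWord z s ∈ W → ∀ s', Reads (wordStep loop opt) {b} none s' → extWord z s' ∈ W := by
  let ws : List (List C) := [z₁, z₂, (loop true).1 :: (loop true).2,
    (loop false).1 :: (loop false).2, (opt true).1 :: (opt true).2.1,
    (opt false).1 :: (opt false).2.1]
  let S : Set (WordVertex C) := insert none
    {x | ∃ c l t, x = some (c, l, t) ∧ ∃ w ∈ ws, c :: l <:+ w}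
  have hS : S.Finite := by
    refine Set.Finite.insert none (Set.Finite.subset (Set.Finite.image
      (fun p : List C × Option Bool => (match p.1 with
        | [] => none
        | c :: l => some (c, l, p.2) : WordVertex C))
      (Set.Finite.prod (s := ⋃ w ∈ {w | w ∈ ws}, {l | l ∈ w.tails}) (t := Set.univ)
        ((List.finite_toSet ws).biUnion fun w _ => List.finite_toSet w.tails)
        Set.finite_univ)) ?_)
    rintro _ ⟨c, l, t, rfl, w, hw, hl⟩
    refine ⟨(c :: l, t), ⟨?_, trivial⟩, rfl⟩
    simp only [Set.mem_iUnion]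
    exact ⟨w, hw, (List.mem_tails _ _).mpr hl⟩
  have henter : ∀ w ∈ ws, ∀ l, l <:+ w → ∀ t, wordEnter loop l t ∈ S := by
    intro w hw l hl t
    cases l with
    | nil =>
      cases t with
      | none => exact Or.inl rfl
      | some j =>
        refine Or.inr ⟨_, _, _, rfl, _, ?_, List.suffix_rfl⟩
        cases j <;> simp [ws]
    | cons c l => exact Or.inr ⟨c, l, t, rfl, w, hw, hl⟩
  obtain ⟨b, hb⟩ := exists_positional_choice hW (step := wordStep loop opt) (hub := none)
    (by
      rintro (_ | ⟨c, l, t⟩) hx b b'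
      · exact (hx rfl).elim
      · rfl) hS (Or.inl rfl)
    (by
      rintro b _ (rfl | ⟨c, l, t, rfl, w, hw, hl⟩)
      · refine henter ((opt b).1 :: (opt b).2.1) ?_ _ (List.suffix_cons _ _) _
        cases b <;> simp [ws]
      · exact henter w hw l ((List.suffix_cons c l).trans hl) t)
  refine ⟨b, fun z hz s hs hzs s' hs' => ?_⟩
  refine hb (wordEnter loop z none) ?_ _ hzs
    (reads_enter (t := none) Set.univ_nonempty hs z) _
    (reads_enter (t := none) (Set.singleton_nonempty b) hs' z)
  refine henter z ?_ z List.suffix_rfl none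
  rcases hz with rfl | rfl <;> simp [ws]

/-- If the `ω`-powers of two cycles are losing after `z`, so is alternating between them. -/
theorem flower_dichotomy {W : Set (ℕ → C)} (hW : HalfPosFinOnePlayer W) {z w₁ w₂ : List C}
    (h₁ : w₁ ≠ []) (h₂ : w₂ ≠ []) {s s₁ s₂ : ℕ → C} (hs : s = extWord (w₁ ++ w₂) s)
    (hs₁ : s₁ = extWord w₁ s₁) (hs₂ : s₂ = extWord w₂ s₂) (hz : extWord z s ∈ W) :
    extWord z s₁ ∈ W ∨ extWord z s₂ ∈ W := by
  obtain ⟨c₁, l₁, rfl⟩ := List.exists_cons_of_ne_nil h₁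
  obtain ⟨c₂, l₂, rfl⟩ := List.exists_cons_of_ne_nil h₂
  let opt : Bool → C × List C × Option Bool :=
    fun b => if b then (c₁, l₁, none) else (c₂, l₂, none)
  obtain ⟨b, hb⟩ := exists_positional_option hW (fun _ => (c₁, l₁)) opt z z
  have key := hb z (Or.inl rfl) s (reads_hub (b := true)
    (fun b => if b then s else extWord (c₂ :: l₂) s) not (by
      rintro (_ | _) -
      · exact ⟨trivial, rfl, rfl⟩
      · exact ⟨trivial, rfl, by simpa [opt, ← extWord_append] using hs⟩) trivial) hz
  cases b
  · exact Or.inr (key s₂ (reads_hub (fun _ => s₂) id (by rintro _ rfl; exact ⟨rfl, rfl, hs₂⟩) rfl))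
  · exact Or.inl (key s₁ (reads_hub (fun _ => s₁) id (by rintro _ rfl; exact ⟨rfl, rfl, hs₁⟩) rfl))

/-- If reading a cycle `w` makes `u t ^ ω` winning, then it wins already or `w ^ ω` wins. -/
theorem progress_dichotomy {W : Set (ℕ → C)} (hW : HalfPosFinOnePlayer W) {z w u t : List C}
    (hw : w ≠ []) (ht : t ≠ []) {s s' : ℕ → C} (hs : s = extWord w s) (hs' : s' = extWord t s')
    (hz : extWord z (extWord w (extWord u s')) ∈ W) :
    extWord z s ∈ W ∨ extWord z (extWord u s') ∈ W := by
  obtain ⟨c₁, l₁, rfl⟩ := List.exists_cons_of_ne_nil hw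
  obtain ⟨c₂, l₂, rfl⟩ := List.exists_cons_of_ne_nil ht
  obtain ⟨c, l, hcl⟩ := List.exists_cons_of_ne_nil (l := u ++ c₂ :: l₂) (by simp)
  have hu : extWord u s' = extWord (c :: l) s' := by rw [← hcl, extWord_append, ← hs']
  rw [hu] at hz ⊢
  let opt : Bool → C × List C × Option Bool :=
    fun b => if b then (c₁, l₁, none) else (c, l, some true)
  obtain ⟨b, hb⟩ := exists_positional_option hW (fun _ => (c₂, l₂)) opt z z
  have exit : ∀ B : Set Bool, false ∈ B →
      Reads (wordStep (fun _ => (c₂, l₂)) opt) B none (extWord (c :: l) s') := fun B hB =>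
    reads_option (opt := opt) hB (reads_terminal ⟨_, hB⟩ hs')
  have key := hb z (Or.inl rfl) _
    (reads_option (opt := opt) (b := true) (Set.mem_univ _) (exit Set.univ trivial)) hz
  cases b
  · exact Or.inr (key _ (exit {false} rfl))
  · exact Or.inl (key s (reads_hub (fun _ => s) id (by rintro _ rfl; exact ⟨rfl, rfl, hs⟩) rfl))

/-- Two ultimately periodic words winning after `z₁` and `z₂` respectively: one of them wins
after both. -/
theorem exchange_dichotomy {W : Set (ℕ → C)} (hW : HalfPosFinOnePlayer W)
    {z₁ z₂ u₁ u₂ w₁ w₂ : List C} (h₁ : w₁ ≠ []) (h₂ : w₂ ≠ []) {s₁ s₂ : ℕ → C}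
    (hs₁ : s₁ = extWord w₁ s₁) (hs₂ : s₂ = extWord w₂ s₂)
    (hz₁ : extWord z₁ (extWord u₁ s₁) ∈ W) (hz₂ : extWord z₂ (extWord u₂ s₂) ∈ W) :
    extWord z₁ (extWord u₂ s₂) ∈ W ∨ extWord z₂ (extWord u₁ s₁) ∈ W := by
  obtain ⟨c₁, l₁, rfl⟩ := List.exists_cons_of_ne_nil h₁
  obtain ⟨c₂, l₂, rfl⟩ := List.exists_cons_of_ne_nil h₂
  obtain ⟨d₁, m₁, hd₁⟩ := List.exists_cons_of_ne_nil (l := u₁ ++ c₁ :: l₁) (by simp)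
  obtain ⟨d₂, m₂, hd₂⟩ := List.exists_cons_of_ne_nil (l := u₂ ++ c₂ :: l₂) (by simp)
  have hu₁ : extWord u₁ s₁ = extWord (d₁ :: m₁) s₁ := by rw [← hd₁, extWord_append, ← hs₁]
  have hu₂ : extWord u₂ s₂ = extWord (d₂ :: m₂) s₂ := by rw [← hd₂, extWord_append, ← hs₂]
  rw [hu₁] at hz₁ ⊢
  rw [hu₂] at hz₂ ⊢
  let loop : Bool → C × List C := fun b => if b then (c₁, l₁) else (c₂, l₂)
  let opt : Bool → C × List C × Option Bool :=
    fun b => if b then (d₁, m₁, some true) else (d₂, m₂, some false)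
  have exit₁ : ∀ B : Set Bool, true ∈ B →
      Reads (wordStep loop opt) B none (extWord (d₁ :: m₁) s₁) := fun B hB =>
    reads_option (opt := opt) hB (reads_terminal ⟨_, hB⟩ hs₁)
  have exit₂ : ∀ B : Set Bool, false ∈ B →
      Reads (wordStep loop opt) B none (extWord (d₂ :: m₂) s₂) := fun B hB =>
    reads_option (opt := opt) hB (reads_terminal ⟨_, hB⟩ hs₂)
  obtain ⟨b, hb⟩ := exists_positional_option hW loop opt z₁ z₂
  cases b
  · exact Or.inl (hb z₁ (Or.inl rfl) _ (exit₁ _ trivial) hz₁ _ (exit₂ _ rfl))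
  · exact Or.inr (hb z₂ (Or.inr rfl) _ (exit₂ _ trivial) hz₂ _ (exit₁ _ rfl))

end OneChoiceArenas

section Residuals

variable {C Q : Type}

theorem accFrom_dstar_congr {δ : Q → C → Q} {acc : Q → C → Prop} {p q : Q}
    (h : accFrom δ acc p = accFrom δ acc q) (w : List C) :
    accFrom δ acc (dstar δ p w) = accFrom δ acc (dstar δ q w) := by
  ext s
  rw [← extWord_mem_accFrom, ← extWord_mem_accFrom, h]

theorem exists_reachable_dba {W : Set (ℕ → C)} (h : DBARecognizable W) :
    ∃ (Q : Type) (_ : Finite Q) (q₀ : Q) (δ : Q → C → Q) (acc : Q → C → Prop),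
      accFrom δ acc q₀ = W ∧ ∀ q, ∃ z, dstar δ q₀ z = q := by
  obtain ⟨Q, _, q₀, δ, acc, rfl⟩ := h
  let R := {q : Q // ∃ z, dstar δ q₀ z = q}
  let δ' : R → C → R := fun q c => ⟨δ q c, by
    obtain ⟨z, hz⟩ := q.2
    exact ⟨z ++ [c], by rw [dstar_append, hz]; rfl⟩⟩
  let r₀ : R := ⟨q₀, [], rfl⟩
  have hstar : ∀ (z : List C) (q : R), ((dstar δ' q z : R) : Q) = dstar δ q z := by
    intro z
    induction z with
    | nil => intro q; rfl
    | cons c z ih => intro q; exact ih (δ' q c)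
  have hrun : ∀ s n, ((dbaRun δ' r₀ s n : R) : Q) = dbaRun δ q₀ s n := by
    intro s n
    induction n with
    | zero => rfl
    | succ n ih => simp only [dbaRun, δ', ih]
  refine ⟨R, inferInstance, r₀, δ', fun q c => acc q c, ?_, ?_⟩
  · ext s
    simp only [accFrom, Set.mem_ofPred_eq, hrun]
  · rintro ⟨q, z, rfl⟩
    exact ⟨z, Subtype.ext (hstar z r₀)⟩

/-- Reading `x` is a cycle on the residual of `p`, and repeating it forever is losing. -/
def LosingCycle (δ : Q → C → Q) (acc : Q → C → Prop) (p : Q) (x : List C) : Prop :=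
  accFrom δ acc (dstar δ p x) = accFrom δ acc p ∧
    ∀ s, s = extWord x s → x ≠ [] → s ∉ accFrom δ acc p

/-- The letter residual `c⁻¹X` of an objective. -/
def letterRes (X : Set (ℕ → C)) (c : C) : Set (ℕ → C) := {s | scons c s ∈ X}

theorem letterRes_mono {X Y : Set (ℕ → C)} (h : X ⊆ Y) (c : C) : letterRes X c ⊆ letterRes Y c :=
  fun _ hs => h hs

/-- `(X, c)` is a Büchi transition of the residual automaton when every word that infinitely often
takes it (or a transition from `X` by a letter with the same signature) belongs to `X`. -/
def resAcc {S : Type} (sig : C → S) (X : Set (ℕ → C)) (c : C) : Prop :=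
  ∀ s : ℕ → C, (∀ N, ∃ n ≥ N, dbaRun letterRes X s n = X ∧ sig (s n) = sig c) → s ∈ X

/-- The action of a letter on the automaton. -/
def letterSig (δ : Q → C → Q) (acc : Q → C → Prop) (c : C) : Q → Q × Prop :=
  fun q => (δ q c, acc q c)

variable {δ : Q → C → Q} {acc : Q → C → Prop}

theorem letterRes_accFrom (q : Q) (c : C) :
    letterRes (accFrom δ acc q) c = accFrom δ acc (δ q c) := by
  ext s
  exact scons_mem_accFrom δ acc q c s

theorem dstar_letterRes (q : Q) (w : List C) :
    dstar letterRes (accFrom δ acc q) w = accFrom δ acc (dstar δ q w) := by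
  induction w generalizing q with
  | nil => rfl
  | cons c w ih =>
    change dstar letterRes (letterRes _ c) w = _
    rw [letterRes_accFrom, ih]
    rfl

theorem dbaRun_letterRes (q : Q) (s : ℕ → C) (n : ℕ) :
    dbaRun letterRes (accFrom δ acc q) s n = accFrom δ acc (dbaRun δ q s n) := by
  induction n with
  | zero => rfl
  | succ n ih => rw [dbaRun, ih, letterRes_accFrom, dbaRun]

theorem losingCycle_congr {p q : Q} (h : accFrom δ acc p = accFrom δ acc q) {x : List C}
    (hx : LosingCycle δ acc p x) : LosingCycle δ acc q x :=
  ⟨(accFrom_dstar_congr h x).symm.trans (hx.1.trans h), h ▸ hx.2⟩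

theorem losingCycle_rotate {p : Q} {x y : List C} (h : LosingCycle δ acc p (x ++ y)) :
    LosingCycle δ acc (dstar δ p x) (y ++ x) := by
  obtain ⟨h1, h2⟩ := h
  constructor
  · rw [dstar_append, ← dstar_append δ p x y]
    exact accFrom_dstar_congr h1 x
  · intro s hs hne hmem
    rw [← extWord_mem_accFrom] at hmem
    refine h2 _ ?_ ?_ hmem
    · conv_lhs => rw [hs]
      simp only [extWord_append]
    · intro h
      rw [List.append_eq_nil_iff] at h
      exact hne (by rw [h.1, h.2, List.append_nil])

theorem exists_not_hits_of_losingCycle {p : Q} {x : List C} (h : LosingCycle δ acc p x) :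
    ∃ q, accFrom δ acc q = accFrom δ acc p ∧ ¬ hits δ acc q x := by
  by_cases hx : x = []
  · subst hx; exact ⟨p, rfl, by simp [hits]⟩
  · by_contra hc
    push Not at hc
    obtain ⟨s, hs⟩ := exists_omega_power x hx
    refine h.2 s hs hx (omega_power_mem_of_hits δ acc hs
      {q | accFrom δ acc q = accFrom δ acc p} (fun q hq => ⟨?_, hc q hq⟩) rfl)
    exact (accFrom_dstar_congr hq x).trans h.1

/-- A transition of the residual automaton which is not Büchi lies on a losing cycle. -/
theorem exists_losingCycle_of_not_resAcc [Finite Q] {q : Q} {c : C}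
    (h : ¬ resAcc (letterSig δ acc) (accFrom δ acc q) c) :
    ∃ u, LosingCycle δ acc q (c :: u) := by
  simp only [resAcc, not_forall] at h
  obtain ⟨s, hfreq, hs⟩ := h
  have hs' : ∃ N, ∀ n ≥ N, ¬ acc (dbaRun δ q s n) (s n) := by simpa [accFrom] using hs
  obtain ⟨N, hN⟩ := hs'
  obtain ⟨p, hp⟩ := frequently_fiber (dbaRun δ q s) hfreq
  obtain ⟨i, hi, ⟨hi1, hi2⟩, hi3⟩ := hp N
  obtain ⟨j, hj, -, hj3⟩ := hp (i + 1)
  obtain ⟨k, rfl⟩ : ∃ k, j = i + (k + 1) := ⟨j - i - 1, by omega⟩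
  have hpq : accFrom δ acc p = accFrom δ acc q := by
    rw [← hi3, ← dbaRun_letterRes, hi1]
  have hsig := congrFun hi2 p
  simp only [letterSig, Prod.mk.injEq, eq_iff_iff] at hsig
  have h1 := dstar_seg δ q s i (k + 1)
  have h2 := hits_seg δ acc q s i (k + 1)
  have h2' : ¬ hits δ acc p (s i :: seg s (i + 1) k) := by
    rw [← hi3]
    change ¬ hits δ acc _ (seg s i (k + 1))
    rw [h2]
    rintro ⟨m, hm, -, ha⟩
    exact hN m (by omega) ha
  rw [hi3, hj3] at h1
  have h3 : dstar δ p (c :: seg s (i + 1) k) = p := by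
    change dstar δ (δ p c) _ = p
    rw [← hsig.1]
    exact h1
  have h4 : ¬ hits δ acc p (c :: seg s (i + 1) k) := by
    rw [hits, ← hsig.1, ← hsig.2]
    exact h2'
  refine ⟨seg s (i + 1) k, losingCycle_congr hpq ⟨by rw [h3], fun t ht hne => ?_⟩⟩
  exact omega_power_notMem_of_not_hits δ acc ht hne h3 h4

theorem accFrom_total [Finite Q] {q₀ : Q} (hreach : ∀ q, ∃ z, dstar δ q₀ z = q)
    (hW : HalfPosFinOnePlayer (accFrom δ acc q₀))
    (p q : Q) :
    accFrom δ acc p ⊆ accFrom δ acc q ∨ accFrom δ acc q ⊆ accFrom δ acc p := by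
  by_contra! hc
  obtain ⟨u₁, w₁, s₁, hw₁, hs₁, hp₁, hq₁⟩ := exists_ultimately_periodic δ acc hc.1
  obtain ⟨u₂, w₂, s₂, hw₂, hs₂, hq₂, hp₂⟩ := exists_ultimately_periodic δ acc hc.2
  obtain ⟨z₁, rfl⟩ := hreach p
  obtain ⟨z₂, rfl⟩ := hreach q
  rw [← extWord_mem_accFrom] at hp₁ hq₁ hp₂ hq₂
  rcases exchange_dichotomy hW hw₁ hw₂ hs₁ hs₂ hp₁ hq₂ with h | h
  · exact hp₂ h
  · exact hq₁ h

theorem accFrom_progress [Finite Q] {q₀ : Q} (hreach : ∀ q, ∃ z, dstar δ q₀ z = q)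
    (hW : HalfPosFinOnePlayer (accFrom δ acc q₀))
    {p : Q} {w : List C} {s : ℕ → C} (hs : s = extWord w s)
    (hp : ¬ accFrom δ acc (dstar δ p w) ⊆ accFrom δ acc p) : s ∈ accFrom δ acc p := by
  have hw : w ≠ [] := by
    rintro rfl
    exact hp subset_rfl
  obtain ⟨u, t, s', ht, hs', h1, h2⟩ := exists_ultimately_periodic δ acc hp
  obtain ⟨z, rfl⟩ := hreach p
  rw [← extWord_mem_accFrom, ← extWord_mem_accFrom] at h1
  rw [← extWord_mem_accFrom] at h2 ⊢
  exact (progress_dichotomy hW hw ht hs hs' h1).resolve_right h2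

theorem losingCycle_append {q₀ : Q} (hreach : ∀ q, ∃ z, dstar δ q₀ z = q)
    (hW : HalfPosFinOnePlayer (accFrom δ acc q₀))
    {p : Q} {x y : List C} (hx : LosingCycle δ acc p x)
    (hy : LosingCycle δ acc p y) : LosingCycle δ acc p (x ++ y) := by
  by_cases hxe : x = []
  · subst hxe; exact hy
  by_cases hye : y = []
  · subst hye; simpa using hx
  refine ⟨?_, fun s hs _ hmem => ?_⟩
  · rw [dstar_append]
    exact (accFrom_dstar_congr hx.1 y).trans hy.1
  · obtain ⟨s₁, hs₁⟩ := exists_omega_power x hxe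
    obtain ⟨s₂, hs₂⟩ := exists_omega_power y hye
    obtain ⟨z, rfl⟩ := hreach p
    rw [← extWord_mem_accFrom] at hmem
    rcases flower_dichotomy hW hxe hye hs hs₁ hs₂ hmem with h | h
    · exact hx.2 s₁ hs₁ hxe ((extWord_mem_accFrom δ acc _ _ _).mp h)
    · exact hy.2 s₂ hs₂ hye ((extWord_mem_accFrom δ acc _ _ _).mp h)

/-- A word taking no Büchi transition of the residual automaton extends to a losing cycle. -/
theorem exists_losingCycle_of_not_hits [Finite Q] {q₀ : Q} (hreach : ∀ q, ∃ z, dstar δ q₀ z = q)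
    (hW : HalfPosFinOnePlayer (accFrom δ acc q₀))
    (w : List C) (q : Q)
    (h : ¬ hits letterRes (resAcc (letterSig δ acc)) (accFrom δ acc q) w) :
    ∃ u, LosingCycle δ acc q (w ++ u) := by
  induction w generalizing q with
  | nil => exact ⟨[], rfl, fun s _ h => (h rfl).elim⟩
  | cons c w ih =>
    rw [hits, not_or, letterRes_accFrom] at h
    obtain ⟨u, hu⟩ := ih _ h.2
    obtain ⟨v, hv⟩ := exists_losingCycle_of_not_resAcc h.1
    have hv' : LosingCycle δ acc (δ q c) (v ++ [c]) := losingCycle_rotate (x := [c]) hv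
    have h1 := losingCycle_append hreach hW hu hv'
    rw [← List.append_assoc] at h1
    refine ⟨u ++ v, ?_⟩
    have h2 := losingCycle_rotate h1
    refine losingCycle_congr ?_ (x := c :: w ++ (u ++ v)) (by simpa using h2)
    rw [dstar_append, dstar_append, ← dstar_append δ _ w u, ← dstar_append δ, dstar_append δ,
      accFrom_dstar_congr hu.1 v]
    exact hv.1

theorem hits_residual_of_hits [Finite Q] {q₀ : Q} (hreach : ∀ q, ∃ z, dstar δ q₀ z = q)
    (hW : HalfPosFinOnePlayer (accFrom δ acc q₀))
    {q : Q} {w : List C} (hq : dstar δ q w = q)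
    (hh : hits δ acc q w) : hits letterRes (resAcc (letterSig δ acc)) (accFrom δ acc q) w := by
  by_contra hn
  have hw : w ≠ [] := by rintro rfl; exact hh
  have hpow : ∀ k, ¬ hits letterRes (resAcc (letterSig δ acc)) (accFrom δ acc q) (wpow w k) := by
    intro k
    induction k with
    | zero => simp [wpow, hits]
    | succ k ih => rw [wpow, hits_append, dstar_letterRes, hq, not_or]; exact ⟨hn, ih⟩
  obtain ⟨s, hs⟩ := exists_omega_power w hw
  have hsq : s ∈ accFrom δ acc q :=
    omega_power_mem_of_hits δ acc hs {q} (by rintro _ rfl; exact ⟨hq, hh⟩) rfl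
  have hno : ∀ k, ∃ p, accFrom δ acc p = accFrom δ acc q ∧ ¬ hits δ acc p (wpow w k) := by
    intro k
    obtain ⟨u, hu⟩ := exists_losingCycle_of_not_hits hreach hW _ q (hpow k)
    obtain ⟨p, hp, hp'⟩ := exists_not_hits_of_losingCycle hu
    rw [hits_append, not_or] at hp'
    exact ⟨p, hp, hp'.1⟩
  obtain ⟨p, hp, hp'⟩ := hno (Nat.card Q)
  have hclass : ∀ i, accFrom δ acc (dstar δ p (wpow w i)) = accFrom δ acc q := by
    intro i
    rw [accFrom_dstar_congr hp]
    induction i with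
    | zero => rfl
    | succ i ih => rw [wpow, dstar_append, hq, ih]
  have hinj : ¬ Function.Injective
      (fun i : Fin (Nat.card Q + 1) => dstar δ p (wpow w i)) := by
    intro h
    have := Nat.card_le_card_of_injective _ h
    simp at this
  have hij : ∃ i j, i < j ∧ j ≤ Nat.card Q ∧
      dstar δ p (wpow w i) = dstar δ p (wpow w j) := by
    simp only [Function.Injective, not_forall] at hinj
    obtain ⟨i, j, hij, hne⟩ := hinj
    rcases lt_or_gt_of_ne hne with h | h
    · exact ⟨i, j, h, by omega, hij⟩
    · exact ⟨j, i, h, by omega, hij.symm⟩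
  obtain ⟨i, j, hlt, hj, heq⟩ := hij
  obtain ⟨d, rfl⟩ : ∃ d, j = i + (d + 1) := ⟨j - i - 1, by omega⟩
  obtain ⟨e, he⟩ : ∃ e, Nat.card Q = i + (d + 1) + e := ⟨_, (Nat.add_sub_of_le hj).symm⟩
  rw [he, wpow_add, wpow_add, hits_append, hits_append] at hp'
  push Not at hp'
  rw [wpow_add, dstar_append] at heq
  refine omega_power_notMem_of_not_hits δ acc (extWord_wpow hs (d + 1)) (by simp [wpow, hw])
    heq.symm hp'.1.2 ?_
  rw [hclass]
  exact hsq

/-- The residual automaton recognizes each of the residuals. -/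
theorem accFrom_residual [Finite Q] {q₀ : Q} (hreach : ∀ q, ∃ z, dstar δ q₀ z = q)
    (hW : HalfPosFinOnePlayer (accFrom δ acc q₀))
    (q : Q) :
    accFrom letterRes (resAcc (letterSig δ acc)) (accFrom δ acc q) = accFrom δ acc q := by
  ext s
  constructor
  · intro h
    obtain ⟨⟨p, σ⟩, hp⟩ := frequently_fiber
      (fun n => (dbaRun δ q s n, letterSig δ acc (s n))) h
    simp only [Prod.mk.injEq] at hp
    obtain ⟨i, -, hi, hi1, hi2⟩ := hp 0
    rw [← sdrop_mem_accFrom δ acc q s i]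
    rw [dbaRun_letterRes] at hi
    refine hi _ fun N => ?_
    obtain ⟨j, hj, -, hj1, hj2⟩ := hp (N + i)
    obtain ⟨k, rfl⟩ : ∃ k, j = i + k := ⟨j - i, by omega⟩
    refine ⟨k, by omega, ?_, ?_⟩
    · rw [dbaRun_letterRes, dbaRun_sdrop, hj1, hi1]
    · exact hj2.trans hi2.symm
  · intro h
    by_contra hc
    have hc' : ∃ N, ∀ n ≥ N, ¬ resAcc (letterSig δ acc)
        (dbaRun letterRes (accFrom δ acc q) s n) (s n) := by
      simpa [accFrom] using hc
    obtain ⟨N, hN⟩ := hc'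
    obtain ⟨a, ha⟩ := frequently_fiber (P := fun _ => True) (dbaRun δ q s)
      (fun N => ⟨N, le_rfl, trivial⟩)
    obtain ⟨i, hi, -, hi'⟩ := ha N
    obtain ⟨m, hm, hacc⟩ := h i
    obtain ⟨j, hj, -, hj'⟩ := ha (m + 1)
    obtain ⟨k, rfl⟩ : ∃ k, j = i + k := ⟨j - i, by omega⟩
    have h1 := dstar_seg δ q s i k
    have h2 := (hits_seg δ acc q s i k).mpr ⟨m, hm, by omega, hacc⟩
    have h3 := hits_seg letterRes (resAcc (letterSig δ acc)) (accFrom δ acc q) s i k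
    rw [hi'] at h1 h2
    rw [dbaRun_letterRes, hi'] at h3
    obtain ⟨m', hm', -, hm''⟩ := h3.mp (hits_residual_of_hits hreach hW (h1.trans hj') h2)
    exact hN m' (by omega) hm''

end Residuals

section Games

variable {C : Type} {V : Type u} {E : Set (V × C × V)} {own1 : V → Prop}

/-- Player 1 wins from `v` for the objective `X`. -/
def Wins (E : Set (V × C × V)) (own1 : V → Prop) (v : V) (X : Set (ℕ → C)) : Prop :=
  ∃ τ : Strat C V, ValidStrat E own1 τ ∧ WinningFrom X E own1 τ v

theorem histPref_succ (p : ℕ → V) (col : ℕ → C) (n : ℕ) :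
    histPref p col (n + 1) = histPref p col n ++ [(p n, col n)] := by
  simp [histPref, List.range_succ]

theorem histPref_succ' (p : ℕ → V) (col : ℕ → C) (n : ℕ) :
    histPref p col (n + 1) =
      (p 0, col 0) :: histPref (fun k => p (k + 1)) (fun k => col (k + 1)) n := by
  simp only [histPref, List.range_succ_eq_map, List.map_cons, List.map_map]
  rfl

/-- After a consistent move, the strategy that remembers this move wins for the letter residual. -/
theorem winningFrom_shift {X : Set (ℕ → C)} {τ : Strat C V} {v v' : V} {c : C}
    (hτ : WinningFrom X E own1 τ v) (he : (v, c, v') ∈ E)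
    (hc : own1 v → (c, v') = τ [] v) :
    WinningFrom (letterRes X c) E own1 (fun h u => τ ((v, c) :: h) u) v' := by
  rintro p col hp rfl hcons
  refine hτ (fun n => Nat.casesOn n v p) (scons c col) ?_ rfl ?_
  · intro n
    cases n with
    | zero => exact he
    | succ n => exact hp n
  · intro n hn
    cases n with
    | zero => exact hc hn
    | succ n =>
      rw [histPref_succ']
      exact hcons n hn

theorem wins_of_opponent_edge {X : Set (ℕ → C)} {v v' : V} {c : C} (h : Wins E own1 v X)
    (hv : ¬ own1 v) (he : (v, c, v') ∈ E) : Wins E own1 v' (letterRes X c) := by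
  obtain ⟨τ, h1, h2⟩ := h
  exact ⟨_, fun _ u hu => h1 _ u hu, winningFrom_shift h2 he fun h => (hv h).elim⟩

/-- From `v`, with objective tracked by the residual `X`, Player 1 can force a Büchi transition
within `o` steps while remaining in winning positions. -/
def BuchiRank (E : Set (V × C × V)) (own1 : V → Prop) (β : Set (ℕ → C) → C → Prop)
    (o : Ordinal.{u}) (v : V) (X : Set (ℕ → C)) : Prop :=
  (own1 v → ∃ c v', (v, c, v') ∈ E ∧ Wins E own1 v' (letterRes X c) ∧
    (β X c ∨ ∃ o', ∃ _ : o' < o, BuchiRank E own1 β o' v' (letterRes X c))) ∧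
  (¬ own1 v → ∀ c v', (v, c, v') ∈ E →
    (β X c ∨ ∃ o', ∃ _ : o' < o, BuchiRank E own1 β o' v' (letterRes X c)))
termination_by o

theorem buchiRank_iff (β : Set (ℕ → C) → C → Prop) (o : Ordinal.{u}) (v : V) (X : Set (ℕ → C)) :
    BuchiRank E own1 β o v X ↔
      (own1 v → ∃ c v', (v, c, v') ∈ E ∧ Wins E own1 v' (letterRes X c) ∧
        (β X c ∨ ∃ o' < o, BuchiRank E own1 β o' v' (letterRes X c))) ∧
      (¬ own1 v → ∀ c v', (v, c, v') ∈ E →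
        (β X c ∨ ∃ o' < o, BuchiRank E own1 β o' v' (letterRes X c))) := by
  rw [BuchiRank]
  simp only [exists_prop]

theorem exists_unranked_successor
    {β : Set (ℕ → C) → C → Prop} {v : V} {X : Set (ℕ → C)} {τ : Strat C V}
    (hτ : ValidStrat E own1 τ) (hwin : WinningFrom X E own1 τ v)
    (hr : ∀ o, ¬ BuchiRank E own1 β o v X) :
    ∃ c v', (v, c, v') ∈ E ∧ (own1 v → (c, v') = τ [] v) ∧ ¬ β X c ∧
      ∀ o, ¬ BuchiRank E own1 β o v' (letterRes X c) := by
  by_cases hv : own1 v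
  · have he := hτ [] v hv
    have hw : Wins E own1 (τ [] v).2 (letterRes X (τ [] v).1) :=
      ⟨_, fun _ u hu => hτ _ u hu, winningFrom_shift hwin he fun _ => rfl⟩
    refine ⟨(τ [] v).1, (τ [] v).2, he, fun _ => rfl, fun hβ => ?_, fun o ho => ?_⟩
    · exact hr 0 ((buchiRank_iff _ _ _ _).mpr
        ⟨fun _ => ⟨_, _, he, hw, Or.inl hβ⟩, fun h => (h hv).elim⟩)
    · exact hr (Order.succ o) ((buchiRank_iff _ _ _ _).mpr
        ⟨fun _ => ⟨_, _, he, hw, Or.inr ⟨o, Order.lt_succ o, ho⟩⟩, fun h => (h hv).elim⟩)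
  · by_contra! hc
    have h1 : ∀ e : C × V, ∃ o, (v, e.1, e.2) ∈ E → ¬ β X e.1 →
        BuchiRank E own1 β o e.2 (letterRes X e.1) := by
      rintro ⟨c, v'⟩
      by_cases h : (v, c, v') ∈ E ∧ ¬ β X c
      · obtain ⟨o, ho⟩ := hc c v' h.1 (fun h => (hv h).elim) h.2
        exact ⟨o, fun _ _ => ho⟩
      · exact ⟨0, fun h1 h2 => (h ⟨h1, h2⟩).elim⟩
    choose f hf using h1
    refine hr (Order.succ (⨆ e, f e)) ((buchiRank_iff _ _ _ _).mpr
      ⟨fun h => (hv h).elim, fun _ c v' he => ?_⟩)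
    by_cases hβ : β X c
    · exact Or.inl hβ
    · exact Or.inr ⟨f (c, v'), Order.lt_succ_of_le (Ordinal.le_iSup f (c, v')),
        hf (c, v') he hβ⟩

theorem exists_buchiRank {β : Set (ℕ → C) → C → Prop} {v : V} {X : Set (ℕ → C)} (hX : accFrom letterRes β X = X) (h : Wins E own1 v X) :
    ∃ o, BuchiRank E own1 β o v X := by
  by_contra! hr
  obtain ⟨τ, hτ, hwin⟩ := h
  let T := {t : V × Set (ℕ → C) × Strat C V // ValidStrat E own1 t.2.2 ∧
    WinningFrom t.2.1 E own1 t.2.2 t.1 ∧ ∀ o, ¬ BuchiRank E own1 β o t.1 t.2.1}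
  have step : ∀ t : T, ∃ (t' : T) (c : C), (t.1.1, c, t'.1.1) ∈ E ∧
      t'.1.2.1 = letterRes t.1.2.1 c ∧
      (∀ h u, t'.1.2.2 h u = t.1.2.2 ((t.1.1, c) :: h) u) ∧
      (own1 t.1.1 → (c, t'.1.1) = t.1.2.2 [] t.1.1) ∧ ¬ β t.1.2.1 c := by
    rintro ⟨⟨v, X, τ⟩, h1, h2, h3⟩
    obtain ⟨c, v', he, hc, hβ, hr'⟩ := exists_unranked_successor h1 h2 h3
    exact ⟨⟨⟨v', letterRes X c, fun h u => τ ((v, c) :: h) u⟩, fun _ u hu => h1 _ u hu,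
      winningFrom_shift h2 he hc, hr'⟩, c, he, rfl, fun _ _ => rfl, hc, hβ⟩
  choose f g hf using step
  let t : ℕ → T := fun n => f^[n] ⟨⟨v, X, τ⟩, hτ, hwin, hr⟩
  have ht : ∀ n, t (n + 1) = f (t n) := fun n => Function.iterate_succ_apply' f n _
  let p : ℕ → V := fun n => (t n).1.1
  let col : ℕ → C := fun n => g (t n)
  have hstrat : ∀ n h u, (t n).1.2.2 h u = τ (histPref p col n ++ h) u := by
    intro n
    induction n with
    | zero => intro h u; rfl
    | succ n ih =>
      intro h u
      rw [ht, (hf (t n)).2.2.1, ih, histPref_succ, List.append_assoc]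
      rfl
  have hres : ∀ n, (t n).1.2.1 = dbaRun letterRes X col n := by
    intro n
    induction n with
    | zero => rfl
    | succ n ih => rw [ht, (hf (t n)).2.1, ih, dbaRun]
  have hcol : col ∈ X := by
    refine hwin p col (fun n => ?_) rfl (fun n hn => ?_)
    · change (p n, col n, (t (n + 1)).1.1) ∈ E
      rw [ht]
      exact (hf (t n)).1
    · change (col n, (t (n + 1)).1.1) = _
      rw [ht, (hf (t n)).2.2.2.1 hn, hstrat, List.append_nil]
  rw [← hX] at hcol
  obtain ⟨n, -, hn⟩ := hcol 0
  rw [← hres] at hn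
  exact (hf (t n)).2.2.2.2 hn

theorem sdrop_mem_dbaRun_letterRes (X : Set (ℕ → C)) (s : ℕ → C) (n : ℕ) :
    sdrop s n ∈ dbaRun letterRes X s n ↔ s ∈ X := by
  induction n with
  | zero => rw [sdrop_zero]; rfl
  | succ n ih => rw [← ih, ← scons_sdrop s n]; rfl

theorem subset_dbaRun_letterRes {s : ℕ → C} {X : ℕ → Set (ℕ → C)}
    (hX : ∀ n, X (n + 1) ⊆ letterRes (X n) (s n)) (i k : ℕ) :
    X (i + k) ⊆ dbaRun letterRes (X i) (sdrop s i) k := by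
  induction k with
  | zero => exact subset_rfl
  | succ k ih => exact (hX (i + k)).trans (letterRes_mono ih _)

/-- Words along which a demand in a finite family of residuals decreases, with a rank decreasing
whenever no Büchi transition is taken and the demand is tight, meet the initial demand. -/
theorem mem_of_demands {R : Set (Set (ℕ → C))} (hfin : R.Finite)
    (hclosed : ∀ X ∈ R, ∀ c, letterRes X c ∈ R) {β : Set (ℕ → C) → C → Prop}
    (hβ : ∀ X ∈ R, accFrom letterRes β X = X)
    (hprog : ∀ X ∈ R, ∀ (w : List C) (s : ℕ → C), s = extWord w s →
      ¬ dstar letterRes X w ⊆ X → s ∈ X)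
    {s : ℕ → C} {X : ℕ → Set (ℕ → C)} {ρ : ℕ → Ordinal.{u}} (hXR : ∀ n, X n ∈ R)
    (hX : ∀ n, X (n + 1) ⊆ letterRes (X n) (s n))
    (hρ : ∀ n, X (n + 1) = letterRes (X n) (s n) → ¬ β (X n) (s n) → ρ (n + 1) < ρ n) :
    s ∈ X 0 := by
  by_contra hs
  have hYR : ∀ n, dbaRun letterRes (X 0) s n ∈ R := by
    intro n
    induction n with
    | zero => exact hXR 0
    | succ n ih => exact hclosed _ ih _
  have hN : ∃ N, ∀ n ≥ N, ¬ β (dbaRun letterRes (X 0) s n) (s n) := by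
    rw [← hβ _ (hXR 0)] at hs
    simpa [accFrom] using hs
  obtain ⟨N, hN⟩ := hN
  have hXY : ∀ n, X n ⊆ dbaRun letterRes (X 0) s n := by
    intro n
    have := subset_dbaRun_letterRes hX 0 n
    rwa [zero_add, sdrop_zero] at this
  by_cases hdrop : ∀ M, ∃ n ≥ M, X (n + 1) ≠ letterRes (X n) (s n)
  · have := hfin.to_subtype
    obtain ⟨⟨⟨A, hA⟩, ⟨P, hP⟩⟩, hAP⟩ := frequently_fiber
      (fun n => ((⟨X (n + 1), hXR _⟩, ⟨_, hYR (n + 1)⟩) : R × R)) hdrop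
    simp only [Prod.mk.injEq, Subtype.mk.injEq] at hAP
    obtain ⟨i, hi, -, hiA, hiP⟩ := hAP N
    obtain ⟨j, hj, hne, hjA, hjP⟩ := hAP (i + 1)
    obtain ⟨k, rfl⟩ : ∃ k, j = i + 1 + k := ⟨j - (i + 1), by omega⟩
    set t := sdrop s (i + 1) with ht
    have hw : seg t 0 (k + 1) ≠ [] := by simp [seg]
    have hrunP : ∀ n, dbaRun letterRes P t n = dbaRun letterRes (X 0) s (i + 1 + n) := by
      intro n
      rw [← hiP, ht, dbaRun_sdrop]
    have hstar : ∀ Z, dstar letterRes Z (seg t 0 (k + 1)) = dbaRun letterRes Z t (k + 1) := by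
      intro Z
      have := dstar_seg letterRes Z t 0 (k + 1)
      rwa [zero_add] at this
    obtain ⟨r, hr⟩ := exists_omega_power _ hw
    have hrA : r ∈ A := by
      refine hprog A hA _ r hr fun hsub => hne (Set.Subset.antisymm (hX _) ?_)
      rw [hstar] at hsub
      rw [hjA]
      refine subset_trans (letterRes_mono ?_ _) hsub
      have := subset_dbaRun_letterRes hX (i + 1) k
      rwa [hiA] at this
    have hAP' : A ⊆ P := by
      rw [← hiA, ← hiP]
      exact hXY _
    have hnot : r ∉ accFrom letterRes β P := by
      refine omega_power_notMem_of_not_hits letterRes β hr hw ?_ ?_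
      · rw [hstar, hrunP]
        exact hjP
      · have h1 := hits_seg letterRes β P t 0 (k + 1)
        rw [show dbaRun letterRes P t 0 = P from rfl] at h1
        rw [h1]
        rintro ⟨m, -, -, hm⟩
        rw [hrunP] at hm
        exact hN _ (by omega) hm
    rw [hβ P hP] at hnot
    exact hnot (hAP' hrA)
  · push Not at hdrop
    obtain ⟨M, hM⟩ := hdrop
    have hrun : ∀ n, dbaRun letterRes (X M) (sdrop s M) n = X (M + n) := by
      intro n
      induction n with
      | zero => rfl
      | succ n ih => rw [dbaRun, ih, ← add_assoc, hM _ (by omega)]; rfl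
    refine hs ((sdrop_mem_dbaRun_letterRes (X 0) s M).mp (hXY M ?_))
    by_contra hc
    have hK : ∃ K, ∀ n ≥ K, ¬ β (dbaRun letterRes (X M) (sdrop s M) n) (sdrop s M n) := by
      rw [← hβ _ (hXR M)] at hc
      simpa [accFrom] using hc
    obtain ⟨K, hK⟩ := hK
    refine not_strictAnti_of_wellFoundedLT (fun k => ρ (M + (K + k)))
      (strictAnti_nat_of_succ_lt fun k => ?_)
    refine hρ (M + (K + k)) (hM _ (by omega)) ?_
    rw [← hrun]
    exact hK _ (by omega)

theorem exists_least_demand {R : Set (Set (ℕ → C))} (hfin : R.Finite)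
    (htot : ∀ X ∈ R, ∀ Y ∈ R, X ⊆ Y ∨ Y ⊆ X) {P : Set (ℕ → C) → Prop} (h : ∃ X ∈ R, P X) :
    ∃ X ∈ R, P X ∧ ∀ Y ∈ R, P Y → X ⊆ Y := by
  obtain ⟨X, hX⟩ := (hfin.subset (Set.sep_subset R P)).exists_minimal h
  refine ⟨X, hX.prop.1, hX.prop.2, fun Y hY hPY => ?_⟩
  rcases htot X hX.prop.1 Y hY with h | h
  · exact h
  · exact hX.le_of_le ⟨hY, hPY⟩ h

theorem halfPositionalAll_of_residuals {W : Set (ℕ → C)} {R : Set (Set (ℕ → C))}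
    (hWR : W ∈ R) (hfin : R.Finite) (hclosed : ∀ X ∈ R, ∀ c, letterRes X c ∈ R)
    (htot : ∀ X ∈ R, ∀ Y ∈ R, X ⊆ Y ∨ Y ⊆ X) {β : Set (ℕ → C) → C → Prop}
    (hβ : ∀ X ∈ R, accFrom letterRes β X = X)
    (hprog : ∀ X ∈ R, ∀ (w : List C) (s : ℕ → C), s = extWord w s →
      ¬ dstar letterRes X w ⊆ X → s ∈ X) : HalfPositionalAll.{u} W := by
  intro V E own1 hE
  have hleast : ∀ v, (∃ X ∈ R, Wins E own1 v X) →
      ∃ X ∈ R, Wins E own1 v X ∧ ∀ Y ∈ R, Wins E own1 v Y → X ⊆ Y :=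
    fun v h => exists_least_demand hfin htot h
  choose! m hmR hmW hmin using hleast
  have hrank : ∀ v, (∃ X ∈ R, Wins E own1 v X) →
      ∃ o, BuchiRank E own1 β o v (m v) ∧ ∀ o', BuchiRank E own1 β o' v (m v) → o ≤ o' := by
    intro v hv
    have h := exists_buchiRank (hβ _ (hmR v hv)) (hmW v hv)
    obtain ⟨o, ho⟩ := exists_minimal_of_wellFoundedLT _ h
    exact ⟨o, ho.prop, fun o' ho' => not_lt.mp fun hlt => hlt.not_ge (ho.le_of_le ho' hlt.le)⟩
  choose! ρ hρ hρmin using hrank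
  have hmove : ∀ v, ∃ c v', (v, c, v') ∈ E ∧ (own1 v → (∃ X ∈ R, Wins E own1 v X) →
      Wins E own1 v' (letterRes (m v) c) ∧
        (β (m v) c ∨ ∃ o' < ρ v, BuchiRank E own1 β o' v' (letterRes (m v) c))) := by
    intro v
    by_cases hv : own1 v ∧ ∃ X ∈ R, Wins E own1 v X
    · obtain ⟨c, v', h1, h2⟩ := ((buchiRank_iff _ _ _ _).mp (hρ v hv.2)).1 hv.1
      exact ⟨c, v', h1, fun _ _ => h2⟩
    · obtain ⟨c, v', h1⟩ := hE v
      exact ⟨c, v', h1, fun h h' => (hv ⟨h, h'⟩).elim⟩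
  choose f g hfg hgood using hmove
  have hstep : ∀ v c v', (∃ X ∈ R, Wins E own1 v X) → (v, c, v') ∈ E →
      (own1 v → (c, v') = (f v, g v)) → Wins E own1 v' (letterRes (m v) c) ∧
        (β (m v) c ∨ ∃ o' < ρ v, BuchiRank E own1 β o' v' (letterRes (m v) c)) := by
    intro v c v' hv he hc
    by_cases hown : own1 v
    · obtain ⟨rfl, rfl⟩ := Prod.mk.inj (hc hown)
      exact hgood v hown hv
    · exact ⟨wins_of_opponent_edge (hmW v hv) hown he,
        ((buchiRank_iff _ _ _ _).mp (hρ v hv)).2 hown c v' he⟩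
  refine ⟨fun _ v => (f v, g v), fun _ v _ => hfg v, fun _ _ _ => rfl, fun v hv => ?_⟩
  rintro p col hp rfl hcons
  have hwin : ∀ n, ∃ X ∈ R, Wins E own1 (p n) X := by
    intro n
    induction n with
    | zero => exact ⟨W, hWR, hv⟩
    | succ n ih => exact ⟨_, hclosed _ (hmR _ ih) _, (hstep _ _ _ ih (hp n) (hcons n)).1⟩
  refine hmin (p 0) (hwin 0) W hWR hv ?_
  refine mem_of_demands hfin hclosed hβ hprog (X := fun n => m (p n)) (ρ := fun n => ρ (p n))
    (fun n => hmR _ (hwin n)) (fun n => ?_) (fun n heq hn => ?_)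
  · exact hmin _ (hwin _) _ (hclosed _ (hmR _ (hwin n)) _) (hstep _ _ _ (hwin n) (hp n) (hcons n)).1
  · obtain ⟨o, ho, hr⟩ := (hstep _ _ _ (hwin n) (hp n) (hcons n)).2.resolve_left hn
    rw [← heq] at hr
    exact (hρmin _ (hwin _) o hr).trans_lt ho

end Games

theorem halfPosFinOnePlayer_of_all {C : Type} {W : Set (ℕ → C)} (h : HalfPositionalAll.{u} W) :
    HalfPosFinOnePlayer W := by
  intro V _ E hE
  let E' : Set (ULift.{u} V × C × ULift.{u} V) := {e | (e.1.down, e.2.1, e.2.2.down) ∈ E}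
  obtain ⟨σ, hσ, hpos, hwin⟩ := h (ULift.{u} V) E' (fun _ => True) (fun v => by
    obtain ⟨c, v', hv⟩ := hE v.down
    exact ⟨c, ⟨v'⟩, hv⟩)
  refine ⟨fun _ v => ((σ [] ⟨v⟩).1, (σ [] ⟨v⟩).2.down), fun _ v _ => hσ [] ⟨v⟩ trivial,
    fun _ _ _ => rfl, ?_⟩
  rintro v ⟨τ, hτ, hτw⟩ p col hp rfl hcons
  let down : ULift.{u} V × C → V × C := fun e => (e.1.down, e.2)
  refine hwin ⟨p 0⟩ ⟨fun h v => ((τ (h.map down) v.down).1,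
    ⟨(τ (h.map down) v.down).2⟩), fun _ v _ => hτ _ v.down trivial, ?_⟩
    (fun n => ⟨p n⟩) col hp rfl ?_
  · intro p' col' hp' h0 hc'
    refine hτw (fun n => (p' n).down) col' hp' (congrArg ULift.down h0) fun n _ => ?_
    have h1 := hc' n trivial
    have h2 : (histPref p' col' n).map down =
        histPref (fun n => (p' n).down) col' n := by simp [histPref, down]
    rw [Prod.ext_iff] at h1
    simp only [h2] at h1
    exact Prod.ext h1.1 (congrArg ULift.down h1.2)
  · intro n _
    have h1 := hcons n trivial
    rw [hpos _ []]
    rw [Prod.ext_iff] at h1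
    exact Prod.ext h1.1 (ULift.ext _ _ h1.2)

theorem halfPositionalAll_of_finOnePlayer {C : Type} {W : Set (ℕ → C)} (hdba : DBARecognizable W)
    (hW : HalfPosFinOnePlayer W) : HalfPositionalAll.{u} W := by
  obtain ⟨Q, _, q₀, δ, acc, rfl, hreach⟩ := exists_reachable_dba hdba
  refine halfPositionalAll_of_residuals (R := Set.range (accFrom δ acc)) ⟨q₀, rfl⟩
    (Set.finite_range _) ?_ ?_ (β := resAcc (letterSig δ acc)) ?_ ?_
  · rintro _ ⟨q, rfl⟩ c
    exact ⟨δ q c, (letterRes_accFrom q c).symm⟩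
  · rintro _ ⟨p, rfl⟩ _ ⟨q, rfl⟩
    exact accFrom_total hreach hW p q
  · rintro _ ⟨q, rfl⟩
    exact accFrom_residual hreach hW q
  · rintro _ ⟨q, rfl⟩ w s hs hsub
    rw [dstar_letterRes] at hsub
    exact accFrom_progress hreach hW hs hsub

/-- for DBA-recognizable objectives, half-positionality over all arenas
(of any cardinality, two-player) is equivalent to half-positionality over finite
one-player arenas. -/
theorem stmt12 {C : Type} (W : Set (ℕ → C)) (hdba : DBARecognizable W) :
    HalfPositionalAll.{u} W ↔ HalfPosFinOnePlayer W :=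
  ⟨halfPosFinOnePlayer_of_all, halfPositionalAll_of_finOnePlayer hdba⟩
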